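/- Let M^1, …, M^N ∈ ℝ^{n×n} be ultra matrices (N ≥ 1) and let C be any valid matrix. Then max_{1≤k≤N} ‖Ũ(C) − M^k‖_∞ ≤ max_{1≤k≤N} ‖C − M^k‖_∞; i.e., applying the ultra-fication to a valid matrix does not increase the radius of the enclosing ball of a family of ultra matrices. -/

import Mathlib

/-- A matrix is *valid* if it is symmetric and each diagonal entry is a
minimum of its row. -/
def IsValid {n : ℕ} (M : Fin n → Fin n → ℝ) : Prop :=
  (∀ i j, M i j = M j i) ∧ (∀ i j, M i i ≤ M i j)

/-- A matrix is *ultra* if it is valid and satisfies the ultrametric-type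
inequality `M i j ≤ max (M i k) (M k j)`. -/
def IsUltra {n : ℕ} (M : Fin n → Fin n → ℝ) : Prop :=
  IsValid M ∧ ∀ i j k, M i j ≤ max (M i k) (M k j)

/-- The value of a path `v 0, …, v k`: the maximum of the edge weights
`M (v l) (v (l+1))` together with the diagonal entries at the two endpoints. -/
def pathVal {n : ℕ} (M : Fin n → Fin n → ℝ) {k : ℕ} (v : Fin (k + 1) → Fin n) : ℝ :=
  Finset.univ.fold max
    (max (M (v 0) (v 0)) (M (v (Fin.last k)) (v (Fin.last k))))
    (fun l : Fin k => M (v l.castSucc) (v l.succ))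

/-- The ultra-fication `Ũ(M)`: entry `(i,j)` is the minimax path value
over all finite paths from `i` to `j` in the complete graph with edge
weights `M u v` (the diagonal entries `M i i`, `M j j` always participate
in the max). -/
noncomputable def ultraFy {n : ℕ} (M : Fin n → Fin n → ℝ) : Fin n → Fin n → ℝ :=
  fun i j => sInf { x | ∃ (k : ℕ) (v : Fin (k + 1) → Fin n),
    v 0 = i ∧ v (Fin.last k) = j ∧ x = pathVal M v }

/-- The entrywise sup distance `‖A - B‖_∞`. -/
noncomputable def supDist {n : ℕ} (A B : Fin n → Fin n → ℝ) : ℝ :=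
  sSup { x | ∃ i j, x = |A i j - B i j| }

theorem pathVal_le_iff {n k : ℕ} (M : Fin n → Fin n → ℝ) (v : Fin (k + 1) → Fin n) (c : ℝ) :
    pathVal M v ≤ c ↔ (M (v 0) (v 0) ≤ c ∧ M (v (Fin.last k)) (v (Fin.last k)) ≤ c) ∧
      ∀ l : Fin k, M (v l.castSucc) (v l.succ) ≤ c := by
  simp [pathVal, Finset.fold_max_le]

theorem ultraFy_set_nonempty {n : ℕ} (M : Fin n → Fin n → ℝ) (i j : Fin n) :
    { x | ∃ (k : ℕ) (v : Fin (k + 1) → Fin n),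
      v 0 = i ∧ v (Fin.last k) = j ∧ x = pathVal M v }.Nonempty :=
  ⟨_, 1, ![i, j], rfl, rfl, rfl⟩

theorem le_ultraFy {n : ℕ} (M : Fin n → Fin n → ℝ) (i j : Fin n) (c : ℝ)
    (h : ∀ (k : ℕ) (v : Fin (k + 1) → Fin n), v 0 = i → v (Fin.last k) = j → c ≤ pathVal M v) :
    c ≤ ultraFy M i j :=
  le_csInf (ultraFy_set_nonempty M i j) <| by
    rintro x ⟨k, v, h0, h1, rfl⟩
    exact h k v h0 h1

theorem IsValid.ultraFy_le {n : ℕ} {M : Fin n → Fin n → ℝ} (hM : IsValid M) (i j : Fin n) :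
    ultraFy M i j ≤ M i j := by
  have hval : pathVal M ![i, j] ≤ M i j := by
    rw [pathVal_le_iff]
    refine ⟨⟨hM.2 i j, (hM.2 j i).trans_eq (hM.1 j i)⟩, fun l => ?_⟩
    rw [Subsingleton.elim l 0]
    exact le_rfl
  refine le_trans (csInf_le ⟨M i i, ?_⟩ ⟨1, ![i, j], rfl, rfl, rfl⟩) hval
  rintro x ⟨k, v, rfl, -, rfl⟩
  exact ((pathVal_le_iff M v _).1 le_rfl).1.1

/-- An ultra matrix is bounded along every path by the value of that path. -/
theorem IsUltra.le_pathVal {n k : ℕ} {M : Fin n → Fin n → ℝ} (hM : IsUltra M)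
    (v : Fin (k + 1) → Fin n) : M (v 0) (v (Fin.last k)) ≤ pathVal M v := by
  obtain ⟨⟨h0, -⟩, hl⟩ := (pathVal_le_iff M v _).1 le_rfl
  suffices ∀ l, M (v 0) (v l) ≤ pathVal M v from this _
  intro l
  induction l using Fin.induction with
  | zero => exact h0
  | succ l ih => exact (hM.2 _ _ (v l.castSucc)).trans (max_le ih (hl l))

theorem pathVal_le_add {n k : ℕ} {A B : Fin n → Fin n → ℝ} {r : ℝ}
    (h : ∀ i j, |A i j - B i j| ≤ r) (v : Fin (k + 1) → Fin n) :
    pathVal B v ≤ pathVal A v + r := by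
  obtain ⟨⟨h0, h1⟩, hl⟩ := (pathVal_le_iff A v _).1 le_rfl
  have hAB : ∀ i j, A i j ≤ pathVal A v → B i j ≤ pathVal A v + r := fun i j hij => by
    linarith [(abs_le.1 (h i j)).1]
  exact (pathVal_le_iff B v _).2 ⟨⟨hAB _ _ h0, hAB _ _ h1⟩, fun l => hAB _ _ (hl l)⟩

theorem abs_sub_le_supDist {n : ℕ} (A B : Fin n → Fin n → ℝ) (i j : Fin n) :
    |A i j - B i j| ≤ supDist A B := by
  refine le_csSup (Set.Finite.bddAbove ?_) ⟨i, j, rfl⟩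
  refine (Set.finite_range fun p : Fin n × Fin n => |A p.1 p.2 - B p.1 p.2|).subset ?_
  rintro x ⟨i, j, rfl⟩
  exact ⟨(i, j), rfl⟩

theorem supDist_nonneg {n : ℕ} (A B : Fin n → Fin n → ℝ) : 0 ≤ supDist A B :=
  Real.sSup_nonneg <| by
    rintro x ⟨i, j, rfl⟩
    exact abs_nonneg _

/-- Ultra-fying a valid matrix does not increase its distance to an ultra matrix. -/
theorem supDist_ultraFy_le {n : ℕ} {C M : Fin n → Fin n → ℝ} (hC : IsValid C) (hM : IsUltra M) :
    supDist (ultraFy C) M ≤ supDist C M := by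
  refine Real.sSup_le ?_ (supDist_nonneg C M)
  rintro x ⟨i, j, rfl⟩
  have hlow : M i j - supDist C M ≤ ultraFy C i j := le_ultraFy C i j _ <| by
    rintro k v rfl rfl
    linarith [hM.le_pathVal v, pathVal_le_add (abs_sub_le_supDist C M) v]
  have hup := (abs_le.1 (abs_sub_le_supDist C M i j)).2
  exact abs_le.2 ⟨by linarith, by linarith [hC.ultraFy_le i j]⟩

/-- Ultra-fying a valid matrix does not increase the radius of the
enclosing ball of a family of ultra matrices. -/
theorem ultraFy_radius_le {n N : ℕ} (hn : 1 ≤ n) (hN : 1 ≤ N)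
    (Ms : Fin N → Fin n → Fin n → ℝ) (hMs : ∀ k, IsUltra (Ms k))
    (C : Fin n → Fin n → ℝ) (hC : IsValid C) :
    Finset.univ.sup' (Finset.univ_nonempty_iff.mpr ⟨⟨0, hN⟩⟩)
        (fun k => supDist (ultraFy C) (Ms k))
      ≤ Finset.univ.sup' (Finset.univ_nonempty_iff.mpr ⟨⟨0, hN⟩⟩)
        (fun k => supDist C (Ms k)) := by
  exact Finset.sup'_mono_fun fun k _ => supDist_ultraFy_le hC (hMs k)
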